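/- arXiv:1911.05535 — 2 statements merged into one kernel-verified Lean document; each statement's English description precedes it below -/
import Mathlib

section
/- Let L ≥ 2 be an integer, let H_L = ∑_{p=1}^{L} 1/p, let κ_L = ∑_{p=2}^{L−1} (1/p) · ∏_{j=0}^{p−1} (L−j)/(2L−j), and for 2 ≤ p ≤ L−1 let ν_p = binom(2L,p) − 2·binom(L,p). Then ∑_{p=1}^{L} 1/p + 1 + ∑_{p=2}^{L−1} ν_p / (p·binom(2L,p)) = 2·(H_L − 1/(2L) − κ_L). In particular, the uMAT closed-form DoF for C = 2 cells, namely 2L / (∑_{p=1}^{L} 1/p + 1 + ∑_{p=2}^{L−1} ν_p/(p·binom(2L,p))), equals L / (H_L − 1/(2L) − κ_L). -/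
theorem cast_choose_succ_mul (n p : ℕ) :
    (n.choose (p + 1) : ℝ) * (p + 1) = n.choose p * ((n : ℝ) - p) := by
  rcases le_or_gt p n with h | h
  · rw [← Nat.cast_sub h]
    exact_mod_cast Nat.choose_succ_right_eq n p
  · simp [Nat.choose_eq_zero_of_lt h, Nat.choose_eq_zero_of_lt (h.trans p.lt_succ_self)]

theorem prod_range_sub_div_sub_eq_choose_div_choose (n m p : ℕ) (hp : p ≤ m) :
    ∏ j ∈ Finset.range p, ((n : ℝ) - j) / ((m : ℝ) - j) = (n.choose p : ℝ) / m.choose p := by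
  induction p with
  | zero => simp
  | succ p ih =>
    have hm : (m : ℝ) - p ≠ 0 := by
      rw [sub_ne_zero]
      exact_mod_cast (Nat.lt_of_succ_le hp).ne'
    have hc : (m.choose p : ℝ) ≠ 0 := by
      exact_mod_cast (Nat.choose_pos (by lia)).ne'
    have hc' : (m.choose (p + 1) : ℝ) ≠ 0 := by
      exact_mod_cast (Nat.choose_pos hp).ne'
    have hp1 : (p : ℝ) + 1 ≠ 0 := by positivity
    rw [Finset.prod_range_succ, ih (by lia), div_mul_div_comm, ← cast_choose_succ_mul,
      ← cast_choose_succ_mul, mul_div_mul_right _ _ hp1]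

theorem sum_Icc_one_div_eq_one_add_sum_add (L : ℕ) (hL : 2 ≤ L) :
    ∑ p ∈ Finset.Icc 1 L, (1 : ℝ) / p =
      1 + ∑ p ∈ Finset.Icc 2 (L - 1), (1 : ℝ) / p + 1 / L := by
  obtain ⟨n, rfl⟩ : ∃ n, L = n + 1 := ⟨L - 1, by lia⟩
  rw [Finset.sum_Icc_succ_top (by lia), ← Finset.add_sum_Ioc_eq_sum_Icc (by lia : 1 ≤ n),
    ← Finset.Icc_add_one_left_eq_Ioc]
  simp


/-- Algebraic step of Lemma 1: rewriting the uMAT closed-form denominator for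
C = 2 cells (K = 2L users) as `2·(H_L − 1/(2L) − κ_L)`, so that the uMAT DoF
`2L / (H_L + 1 + ∑ ν_p/(p·binom(2L,p)))` equals `L / (H_L − 1/(2L) − κ_L)`. -/
theorem umat_two_cells_denominator (L : ℕ) (hL : 2 ≤ L)
    (H κ : ℝ)
    (hH : H = ∑ p ∈ Finset.Icc 1 L, (1 : ℝ) / p)
    (hκ : κ = ∑ p ∈ Finset.Icc 2 (L - 1), (1 / (p : ℝ)) *
      ∏ j ∈ Finset.range p, ((L : ℝ) - j) / (2 * (L : ℝ) - j))
    (ν : ℕ → ℝ)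
    (hν : ∀ p, ν p = ((2 * L).choose p : ℝ) - 2 * (L.choose p : ℝ)) :
    ((∑ p ∈ Finset.Icc 1 L, (1 : ℝ) / p) + 1 +
        ∑ p ∈ Finset.Icc 2 (L - 1), ν p / ((p : ℝ) * ((2 * L).choose p : ℝ)) =
      2 * (H - 1 / (2 * (L : ℝ)) - κ)) ∧
    ((2 * (L : ℝ)) /
        ((∑ p ∈ Finset.Icc 1 L, (1 : ℝ) / p) + 1 +
          ∑ p ∈ Finset.Icc 2 (L - 1), ν p / ((p : ℝ) * ((2 * L).choose p : ℝ))) =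
      (L : ℝ) / (H - 1 / (2 * (L : ℝ)) - κ)) := by
  have hsum : ∑ p ∈ Finset.Icc 2 (L - 1), ν p / ((p : ℝ) * ((2 * L).choose p : ℝ)) =
      ∑ p ∈ Finset.Icc 2 (L - 1), (1 : ℝ) / p - 2 * κ := by
    rw [hκ, Finset.mul_sum, ← Finset.sum_sub_distrib]
    refine Finset.sum_congr rfl fun p hp => ?_
    rw [Finset.mem_Icc] at hp
    have hprod := prod_range_sub_div_sub_eq_choose_div_choose L (2 * L) p (by lia)
    push_cast at hprod
    have hc : ((2 * L).choose p : ℝ) ≠ 0 := by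
      exact_mod_cast (Nat.choose_pos (by lia)).ne'
    have hp0 : (p : ℝ) ≠ 0 := by
      exact_mod_cast (by lia : p ≠ 0)
    rw [hprod, hν]
    field_simp
  have hden : (∑ p ∈ Finset.Icc 1 L, (1 : ℝ) / p) + 1 +
        ∑ p ∈ Finset.Icc 2 (L - 1), ν p / ((p : ℝ) * ((2 * L).choose p : ℝ)) =
      2 * (H - 1 / (2 * (L : ℝ)) - κ) := by
    have hhalf : 1 / (2 * (L : ℝ)) = 1 / L / 2 := by ring
    rw [hsum, ← hH, hhalf]
    linarith [sum_Icc_one_div_eq_one_add_sum_add L hL]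
  exact ⟨hden, by rw [hden, mul_div_mul_left _ _ two_ne_zero]⟩
end

section
/- Define, for integers L ≥ 2, ε_L = L/(H_L − 1/(2L) − κ_L) − L/H_L, where H_L = ∑_{p=1}^{L} 1/p and κ_L = ∑_{p=2}^{L−1} (1/p) · ∏_{j=0}^{p−1} (L−j)/(2L−j). Then ε_L → +∞ as L → ∞. -/
open Filter

theorem sub_div_two_mul_sub_mem_Icc {L j : ℕ} (hj : j < L) :
    0 ≤ ((L : ℝ) - j) / (2 * (L : ℝ) - j) ∧ ((L : ℝ) - j) / (2 * (L : ℝ) - j) ≤ 1 := by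
  have h : (j : ℝ) < L := by exact_mod_cast hj
  have h0 : (0 : ℝ) ≤ j := j.cast_nonneg
  exact ⟨div_nonneg (by linarith) (by linarith), (div_le_one (by linarith)).2 (by linarith)⟩

theorem prod_sub_div_two_mul_sub_nonneg {L p : ℕ} (hp : p ≤ L) :
    0 ≤ ∏ j ∈ Finset.range p, ((L : ℝ) - j) / (2 * (L : ℝ) - j) :=
  Finset.prod_nonneg fun _ hj =>
    (sub_div_two_mul_sub_mem_Icc ((Finset.mem_range.1 hj).trans_le hp)).1

theorem prod_sub_div_two_mul_sub_le_one {L p : ℕ} (hp : p ≤ L) :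
    ∏ j ∈ Finset.range p, ((L : ℝ) - j) / (2 * (L : ℝ) - j) ≤ 1 :=
  Finset.prod_le_one
    (fun _ hj => (sub_div_two_mul_sub_mem_Icc ((Finset.mem_range.1 hj).trans_le hp)).1)
    (fun _ hj => (sub_div_two_mul_sub_mem_Icc ((Finset.mem_range.1 hj).trans_le hp)).2)

/-- The correction sum `κ_L` is bounded below, thanks to its term of index `2`. -/
theorem one_div_ten_le_sum_mul_prod {L : ℕ} (hL : 3 ≤ L) :
    (1 / 10 : ℝ) ≤ ∑ p ∈ Finset.Icc 2 (L - 1), (1 / (p : ℝ)) *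
      ∏ j ∈ Finset.range p, ((L : ℝ) - j) / (2 * (L : ℝ) - j) := by
  have h3 : (3 : ℝ) ≤ L := by exact_mod_cast hL
  have hterm := Finset.single_le_sum (s := Finset.Icc 2 (L - 1))
    (f := fun p : ℕ => (1 / (p : ℝ)) *
      ∏ j ∈ Finset.range p, ((L : ℝ) - j) / (2 * (L : ℝ) - j))
    (fun p hp => mul_nonneg (by positivity) (prod_sub_div_two_mul_sub_nonneg
      (by have := (Finset.mem_Icc.1 hp).2; omega)))
    (Finset.mem_Icc.2 ⟨le_refl 2, by omega⟩)
  refine le_trans ?_ hterm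
  have h1 : (L : ℝ) / (2 * L) = 1 / 2 := by field_simp
  have h2 : (2 / 5 : ℝ) ≤ ((L : ℝ) - 1) / (2 * L - 1) := by
    rw [le_div_iff₀ (by linarith)]
    linarith
  simp only [Finset.prod_range_succ, Finset.prod_range_zero, Nat.cast_zero, Nat.cast_one,
    Nat.cast_ofNat, sub_zero, one_mul, h1]
  linarith

/-- The correction sum `κ_L` is at most `H_L - 1 - 1 / L`. -/
theorem sum_mul_prod_le_harmonic_sub {L : ℕ} (hL : 3 ≤ L) :
    ∑ p ∈ Finset.Icc 2 (L - 1), (1 / (p : ℝ)) *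
      ∏ j ∈ Finset.range p, ((L : ℝ) - j) / (2 * (L : ℝ) - j) ≤
      (∑ p ∈ Finset.Icc 1 L, (1 : ℝ) / p) - 1 - 1 / L := by
  have h : ∑ p ∈ Finset.Icc 1 L, (1 : ℝ) / p =
      1 + ∑ p ∈ Finset.Icc 2 (L - 1), (1 : ℝ) / p + 1 / L := by
    obtain ⟨n, rfl⟩ : ∃ n, L = n + 1 := ⟨L - 1, by omega⟩
    rw [Finset.sum_Icc_succ_top (by omega), Nat.add_sub_cancel,
      ← Finset.add_sum_Ioc_eq_sum_Icc (by omega : 1 ≤ n), ← Finset.Icc_succ_left_eq_Ioc]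
    simp
  rw [h]
  have : ∑ p ∈ Finset.Icc 2 (L - 1), (1 / (p : ℝ)) *
      ∏ j ∈ Finset.range p, ((L : ℝ) - j) / (2 * (L : ℝ) - j) ≤
      ∑ p ∈ Finset.Icc 2 (L - 1), (1 : ℝ) / p :=
    Finset.sum_le_sum fun p hp => mul_le_of_le_one_right (by positivity)
      (prod_sub_div_two_mul_sub_le_one (by have := (Finset.mem_Icc.1 hp).2; omega))
  linarith

theorem sum_Icc_one_div_le_one_add_log (L : ℕ) :
    ∑ p ∈ Finset.Icc 1 L, (1 : ℝ) / p ≤ 1 + Real.log L := by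
  have h := harmonic_le_one_add_log L
  rw [harmonic_eq_sum_Icc] at h
  push_cast at h
  simpa only [one_div] using h

theorem tendsto_div_one_add_log_sq_atTop :
    Tendsto (fun x : ℝ => x / (1 + Real.log x) ^ 2) atTop atTop := by
  have h := (Real.tendsto_pow_log_div_mul_add_atTop (Real.exp (-1)) 0 2
    (Real.exp_pos _).ne').comp (tendsto_id.const_mul_atTop (Real.exp_pos 1))
  have h' : Tendsto (fun x : ℝ => (1 + Real.log x) ^ 2 / x) atTop (nhds 0) := by
    refine h.congr' ?_
    filter_upwards [eventually_gt_atTop 0] with x hx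
    simp only [Function.comp_apply, id]
    rw [Real.log_mul (Real.exp_pos 1).ne' hx.ne', Real.log_exp, ← mul_assoc, ← Real.exp_add]
    simp
  have h'' : Tendsto (fun x : ℝ => (1 + Real.log x) ^ 2 / x) atTop (nhdsWithin 0 (Set.Ioi 0)) := by
    refine tendsto_nhdsWithin_iff.2 ⟨h', ?_⟩
    filter_upwards [eventually_gt_atTop 1] with x hx
    have := Real.log_pos hx
    have hx0 : 0 < x := by linarith
    exact Set.mem_Ioi.2 (by positivity)
  exact h''.inv_tendsto_nhdsGT_zero.congr fun x => by simp

/-- Corollary 1: the DoF gap between uMAT and MAT for C = 2 cells,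
`ε_L = L/(H_L − 1/(2L) − κ_L) − L/H_L`, tends to +∞ as L → ∞. -/
theorem dof_gap_tendsto_atTop :
    Tendsto (fun L : ℕ =>
      (L : ℝ) /
          ((∑ p ∈ Finset.Icc 1 L, (1 : ℝ) / p) - 1 / (2 * (L : ℝ)) -
            ∑ p ∈ Finset.Icc 2 (L - 1), (1 / (p : ℝ)) *
              ∏ j ∈ Finset.range p, ((L : ℝ) - j) / (2 * (L : ℝ) - j)) -
        (L : ℝ) / (∑ p ∈ Finset.Icc 1 L, (1 : ℝ) / p))
      atTop atTop := by
  refine tendsto_atTop_mono' _ ?_ ((tendsto_div_one_add_log_sq_atTop.comp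
    tendsto_natCast_atTop_atTop).const_mul_atTop (by norm_num : (0 : ℝ) < 1 / 10))
  filter_upwards [eventually_ge_atTop 3] with L hL
  have hlow := one_div_ten_le_sum_mul_prod hL
  have hup := sum_mul_prod_le_harmonic_sub hL
  have hlog := sum_Icc_one_div_le_one_add_log L
  have hLpos : (0 : ℝ) < L := by exact_mod_cast (by omega : 0 < L)
  have hhalf : (1 : ℝ) / L = 2 * (1 / (2 * L)) := by field_simp
  have hinv : (0 : ℝ) < 1 / (2 * L) := by positivity
  simp only [Function.comp_apply]
  set H := ∑ p ∈ Finset.Icc 1 L, (1 : ℝ) / p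
  set κ := ∑ p ∈ Finset.Icc 2 (L - 1), (1 / (p : ℝ)) *
    ∏ j ∈ Finset.range p, ((L : ℝ) - j) / (2 * (L : ℝ) - j)
  set δ := (1 : ℝ) / (2 * L)
  have hD : 0 < H - δ - κ := by linarith
  have hH : 0 < H := by linarith
  calc 1 / 10 * ((L : ℝ) / (1 + Real.log L) ^ 2)
      ≤ (δ + κ) * (L / (H * (H - δ - κ))) := by
        have hsq : H * (H - δ - κ) ≤ (1 + Real.log L) ^ 2 := by
          rw [sq]
          exact mul_le_mul hlog (by linarith) hD.le (by linarith)
        gcongr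
        linarith
    _ = L / (H - δ - κ) - L / H := by
        rw [div_sub_div _ _ hD.ne' hH.ne', mul_div_assoc', mul_comm H]
        congr 1
        ring
end
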